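/- Let q̃ : ℝ → ℝ be continuous with q̃(x) → ∞ as x → ∞. Then for every M > 0 there exist a twice continuously differentiable function y solving -y'' + q̃·y = 0 on ℝ and points x₀ ≤ x₁ such that y is strictly positive on [x₀,∞) and |y(x)| ≤ e^{-M·x} for all x ≥ x₁. -/

import Mathlib

open Filter Real

lemma ode_key (q : ℝ → ℝ) (hq : Continuous q) (c : ℝ) (z : ℝ → ℝ × ℝ) (hz : Continuous z) (B : ℝ)
    (hB : ∀ x, ‖z x‖ ≤ B) (W Φ : ℝ → ℝ) (hΦ : Φ = fun x => ∫ s in c..x, (1 + |q s|))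
    (hW : W = fun x => Real.cosh (2 * Φ x)) (x : ℝ) :
    ‖(W x)⁻¹ • ∫ s in c..x, W s • (((z s).2, q s * (z s).1) : ℝ × ℝ)‖ ≤ B / 2 := by
  have hB0 : 0 ≤ B := (norm_nonneg _).trans (hB 0)
  have hK : Continuous fun s => 1 + |q s| := by fun_prop
  have hΦd : ∀ x, HasDerivAt Φ (1 + |q x|) x := by
    intro x; rw [hΦ]
    exact hK.integral_hasStrictDerivAt c x |>.hasDerivAt
  have hΦc : Continuous Φ := continuous_iff_continuousAt.2 fun x => (hΦd x).continuousAt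
  have hWc : Continuous W := by rw [hW]; fun_prop
  have hWpos : ∀ x, 0 < W x := fun x => by rw [hW]; exact Real.cosh_pos _
  have hint : ∫ s in c..x, B * (W s * (1 + |q s|)) = B / 2 * Real.sinh (2 * Φ x) := by
    have hd : ∀ x, HasDerivAt (fun x => B / 2 * Real.sinh (2 * Φ x)) (B * (W x * (1 + |q x|))) x := by
      intro x
      have := (((hΦd x).const_mul 2).sinh).const_mul (B / 2)
      refine this.congr_deriv ?_
      rw [hW]; ring
    rw [intervalIntegral.integral_eq_sub_of_hasDerivAt (fun x _ => hd x)
      ((by fun_prop : Continuous fun s => B * (W s * (1 + |q s|))).intervalIntegrable _ _)]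
    have : Φ c = 0 := by rw [hΦ]; simp
    simp [this]
  have h1 : ‖∫ s in c..x, W s • (((z s).2, q s * (z s).1) : ℝ × ℝ)‖
      ≤ |∫ s in c..x, B * (W s * (1 + |q s|))| := by
    apply intervalIntegral.norm_integral_le_abs_of_norm_le
    · refine Filter.Eventually.of_forall fun s => ?_
      rw [norm_smul, Real.norm_of_nonneg (hWpos s).le]
      have h2 : ‖(((z s).2, q s * (z s).1) : ℝ × ℝ)‖ ≤ (1 + |q s|) * B := by
        have e1 : ‖(z s).1‖ ≤ B := (norm_fst_le _).trans (hB s)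
        have e2 : ‖(z s).2‖ ≤ B := (norm_snd_le _).trans (hB s)
        rw [Prod.norm_mk]
        apply max_le
        · nlinarith [mul_nonneg (abs_nonneg (q s)) hB0]
        · rw [norm_mul, Real.norm_eq_abs (q s)]
          nlinarith [mul_le_mul_of_nonneg_left e1 (abs_nonneg (q s))]
      nlinarith [mul_le_mul_of_nonneg_left h2 (hWpos s).le]
    · exact (by fun_prop : Continuous fun s => B * (W s * (1 + |q s|))).intervalIntegrable _ _
  rw [norm_smul, norm_inv, Real.norm_of_nonneg (hWpos x).le, inv_mul_le_iff₀ (hWpos x)]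
  refine h1.trans ?_
  rw [hint, abs_mul, abs_of_nonneg (by positivity : 0 ≤ B / 2), mul_comm]
  gcongr
  rw [hW, abs_le]
  constructor
  · have := Real.sinh_lt_cosh (-(2 * Φ x))
    rw [Real.sinh_neg, Real.cosh_neg] at this
    simp only; linarith
  · exact (Real.sinh_lt_cosh _).le

lemma ode_exists (q : ℝ → ℝ) (hq : Continuous q) (c a b : ℝ) :
    ∃ u w : ℝ → ℝ, u c = a ∧ w c = b ∧ (∀ x, HasDerivAt u (w x) x) ∧
      ∀ x, HasDerivAt w (q x * u x) x := by
  obtain ⟨Φ, hΦ⟩ : ∃ Φ : ℝ → ℝ, Φ = fun x => ∫ s in c..x, (1 + |q s|) := ⟨_, rfl⟩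
  obtain ⟨W, hW⟩ : ∃ W : ℝ → ℝ, W = fun x => Real.cosh (2 * Φ x) := ⟨_, rfl⟩
  have hK : Continuous fun s => 1 + |q s| := by fun_prop
  have hΦd : ∀ x, HasDerivAt Φ (1 + |q x|) x := by
    intro x; rw [hΦ]
    exact hK.integral_hasStrictDerivAt c x |>.hasDerivAt
  have hΦc : Continuous Φ := continuous_iff_continuousAt.2 fun x => (hΦd x).continuousAt
  have hWc : Continuous W := by rw [hW]; fun_prop
  have hW1 : ∀ x, 1 ≤ W x := fun x => by rw [hW]; exact Real.one_le_cosh _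
  have hW0 : ∀ x, W x ≠ 0 := fun x => (zero_lt_one.trans_le (hW1 x)).ne'
  have hcont : ∀ z : ℝ → ℝ × ℝ, Continuous z →
      Continuous fun s => W s • (((z s).2, q s * (z s).1) : ℝ × ℝ) := fun z hz => by fun_prop
  have hder : ∀ z : ℝ → ℝ × ℝ, Continuous z → ∀ x,
      HasDerivAt (fun x => ∫ s in c..x, W s • (((z s).2, q s * (z s).1) : ℝ × ℝ))
        (W x • (((z x).2, q x * (z x).1) : ℝ × ℝ)) x := fun z hz x =>
    ((hcont z hz).integral_hasStrictDerivAt c x).hasDerivAt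
  have hic : ∀ z : ℝ → ℝ × ℝ, Continuous z →
      Continuous (fun x => ∫ s in c..x, W s • (((z s).2, q s * (z s).1) : ℝ × ℝ)) := fun z hz =>
    continuous_iff_continuousAt.2 fun x => (hder z hz x).continuousAt
  let T : BoundedContinuousFunction ℝ (ℝ × ℝ) → BoundedContinuousFunction ℝ (ℝ × ℝ) := fun z =>
    BoundedContinuousFunction.ofNormedAddCommGroup
      (fun x => (W x)⁻¹ • (((a, b) : ℝ × ℝ) + ∫ s in c..x, W s • (((z s).2, q s * (z s).1) : ℝ × ℝ)))
      ((hWc.inv₀ hW0).smul (continuous_const.add (hic z z.continuous)))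
      (‖((a, b) : ℝ × ℝ)‖ + ‖z‖ / 2)
      (by
        intro x
        rw [smul_add]
        refine (norm_add_le _ _).trans (add_le_add ?_
          (ode_key q hq c z z.continuous ‖z‖ z.norm_coe_le_norm W Φ hΦ hW x))
        rw [norm_smul, norm_inv, Real.norm_of_nonneg (zero_le_one.trans (hW1 x))]
        exact mul_le_of_le_one_left (norm_nonneg _) (inv_le_one_of_one_le₀ (hW1 x)))
  have hT : ∀ z x, T z x = (W x)⁻¹ • (((a, b) : ℝ × ℝ) +
      ∫ s in c..x, W s • (((z s).2, q s * (z s).1) : ℝ × ℝ)) := fun z x => rfl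
  have hC : ContractingWith (1/2) T := by
    refine ⟨by norm_num, LipschitzWith.of_dist_le_mul fun z w => ?_⟩
    rw [BoundedContinuousFunction.dist_le (by positivity)]
    intro x
    rw [dist_eq_norm, hT, hT, ← smul_sub, add_sub_add_left_eq_sub,
      ← intervalIntegral.integral_sub ((hcont z z.continuous).intervalIntegrable _ _)
        ((hcont w w.continuous).intervalIntegrable _ _)]
    have := ode_key q hq c (z - w) (z - w).continuous ‖z - w‖ (z - w).norm_coe_le_norm W Φ hΦ hW x
    rw [dist_eq_norm]
    convert this using 1
    · congr 3
      funext s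
      rw [← smul_sub]
      congr 1
      ext <;> simp [mul_sub]
    · push_cast; ring
  obtain ⟨z, hz, -⟩ := hC.exists_fixedPoint 0 (edist_ne_top _ _)
  have hfix : ∀ x, W x • z x = ((a, b) : ℝ × ℝ) +
      ∫ s in c..x, W s • (((z s).2, q s * (z s).1) : ℝ × ℝ) := by
    intro x
    have : T z x = z x := by rw [hz.eq]
    rw [← this, hT, smul_inv_smul₀ (hW0 x)]
  have hd : ∀ x, HasDerivAt (fun x => W x • z x) (W x • (((z x).2, q x * (z x).1) : ℝ × ℝ)) x := by
    intro x
    have := (hder z z.continuous x).const_add ((a, b) : ℝ × ℝ)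
    rwa [← funext hfix] at this
  have h0 : W c • z c = (a, b) := by rw [hfix c]; simp
  refine ⟨fun x => (W x • z x).1, fun x => (W x • z x).2, by simp [h0], by simp [h0],
    fun x => ?_, fun x => ?_⟩
  · exact (hasFDerivAt_fst.comp_hasDerivAt x (hd x))
  · refine (hasFDerivAt_snd.comp_hasDerivAt x (hd x)).congr_deriv ?_
    simp; ring

lemma mono_aux (c : ℝ) (f f' : ℝ → ℝ) (hf : ∀ x, c ≤ x → HasDerivAt f (f' x) x)
    (h : ∀ x, c ≤ x → 0 ≤ f' x) : MonotoneOn f (Set.Ici c) := by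
  refine monotoneOn_of_hasDerivWithinAt_nonneg (f' := f') (convex_Ici c)
    (fun x hx => (hf x hx).continuousAt.continuousWithinAt) ?_ ?_
  · intro x hx; exact (hf x (interior_subset hx)).hasDerivWithinAt
  · intro x hx; exact h x (interior_subset hx)

theorem decaying_solution_at_plus_infinity
    (qt : ℝ → ℝ) (hqt : Continuous qt)
    (htop : Filter.Tendsto qt Filter.atTop Filter.atTop)
    (M : ℝ) (hM : 0 < M) :
    ∃ y : ℝ → ℝ, ContDiff ℝ 2 y ∧
      (∀ x : ℝ, -(deriv (deriv y) x) + qt x * y x = 0) ∧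
      ∃ x₀ x₁ : ℝ, x₀ ≤ x₁ ∧
        (∀ x : ℝ, x₀ ≤ x → 0 < y x) ∧
        (∀ x : ℝ, x₁ ≤ x → |y x| ≤ Real.exp (-M * x)) := by
  obtain ⟨k, hk⟩ : ∃ k, k = M + 1 := ⟨_, rfl⟩
  have hk1 : 1 < k := by linarith
  obtain ⟨c, hc⟩ := Filter.eventually_atTop.1 (htop.eventually_ge_atTop (k ^ 2))
  obtain ⟨u, u', hu0, hu'0, hu, hu'⟩ := ode_exists qt hqt c 1 k
  obtain ⟨v, v', hv0, hv'0, hv, hv'⟩ := ode_exists qt hqt c 0 1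
  -- p = u u'
  have hp : ∀ x, HasDerivAt (fun x => u x * u' x) (u' x * u' x + u x * (qt x * u x)) x :=
    fun x => (hu x).mul (hu' x)
  have hexp : ∀ m x, HasDerivAt (fun x => Real.exp (m * (x - c))) (Real.exp (m * (x - c)) * m) x := by
    intro m x
    simpa using (((hasDerivAt_id x).sub_const c).const_mul m).exp
  have hplow : ∀ x, c ≤ x → k * Real.exp (2 * k * (x - c)) ≤ u x * u' x := by
    intro x hx
    have hm := mono_aux c _ _ (fun x _ => (hp x).mul (hexp (-(2 * k)) x)) (by
      intro x hx
      have h1 := hc x hx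
      have h2 := Real.exp_pos (-(2 * k) * (x - c))
      have h3 : 0 ≤ (qt x - k ^ 2) * u x ^ 2 := mul_nonneg (by linarith) (sq_nonneg _)
      have h4 : 0 ≤ (u' x * u' x + u x * (qt x * u x)) - 2 * k * (u x * u' x) := by
        nlinarith [sq_nonneg (u' x - k * u x)]
      have := mul_nonneg h4 h2.le
      linarith)
    have := hm (Set.self_mem_Ici) hx hx
    simp only [Pi.mul_apply, hu0, hu'0, sub_self, mul_zero, Real.exp_zero, one_mul, mul_one] at this
    have h2 := mul_le_mul_of_nonneg_right this (Real.exp_pos (2 * k * (x - c))).le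
    rwa [mul_assoc (u x * u' x), ← Real.exp_add, neg_mul, neg_add_cancel, Real.exp_zero, mul_one] at h2
  have hppos : ∀ x, c ≤ x → 0 < u x * u' x := fun x hx => lt_of_lt_of_le (by positivity) (hplow x hx)
  have huc : Continuous u := continuous_iff_continuousAt.2 fun x => (hu x).continuousAt
  have hupos : ∀ x, c ≤ x → 0 < u x := by
    intro x hx
    by_contra! hneg
    obtain ⟨t, ht, ht0⟩ := intermediate_value_Icc' hx huc.continuousOn
      (show (0:ℝ) ∈ Set.Icc (u x) (u c) from ⟨hneg, by rw [hu0]; norm_num⟩)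
    have := hppos t ht.1
    simp [ht0] at this
  have hu'pos : ∀ x, c ≤ x → 0 < u' x := fun x hx =>
    (mul_pos_iff_of_pos_left (hupos x hx)).1 (hppos x hx)
  have hu'low : ∀ x, c ≤ x → k * Real.exp (k * (x - c)) ≤ u' x := by
    intro x hx
    have hm := mono_aux c _ _ (fun x _ => ((hu' x).mul (hu' x)).sub ((hexp (2 * k) x).const_mul (k ^ 2))) (by
      intro x hx
      have h1 := hc x hx
      have h2 := hplow x hx
      have h3 := mul_le_mul_of_nonneg_right h1 (hppos x hx).le
      nlinarith [mul_le_mul_of_nonneg_left h2 (sq_nonneg k)])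
    have := hm (Set.self_mem_Ici) hx hx
    simp only [Pi.mul_apply, Pi.sub_apply, hu'0, sub_self, mul_zero, Real.exp_zero, mul_one] at this
    have e : Real.exp (2 * k * (x - c)) = Real.exp (k * (x - c)) ^ 2 := by
      rw [← Real.exp_nat_mul]; congr 1; push_cast; ring
    rw [e] at this
    refine (abs_le_of_sq_le_sq' ?_ (hu'pos x hx).le).2
    nlinarith
  have hwr : ∀ x, u x * v' x - u' x * v x = 1 := by
    have hd : ∀ x, HasDerivAt (fun x => u x * v' x - u' x * v x) 0 x := by
      intro x
      refine (((hu x).mul (hv' x)).sub ((hu' x).mul (hv x))).congr_deriv ?_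
      ring
    intro x
    have := is_const_of_deriv_eq_zero (fun x => (hd x).differentiableAt) (fun x => (hd x).deriv) x c
    simpa [hu0, hv0, hu'0, hv'0] using this
  have hg : ∀ x, c ≤ x → HasDerivAt (fun x => v x / u x) (1 / u x ^ 2) x := by
    intro x hx
    refine ((hv x).div (hu x) (hupos x hx).ne').congr_deriv ?_
    congr 1
    linarith [hwr x]
  have hgmono : MonotoneOn (fun x => v x / u x) (Set.Ici c) :=
    mono_aux c _ _ hg (fun x _ => by positivity)
  have hgs : StrictMonoOn (fun x => v x / u x) (Set.Ici c) := by
    refine strictMonoOn_of_hasDerivWithinAt_pos (f' := fun x => 1 / u x ^ 2) (convex_Ici c)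
      (fun x hx => (hg x hx).continuousAt.continuousWithinAt) ?_ ?_
    · intro x hx; exact (hg x (interior_subset hx)).hasDerivWithinAt
    · intro x hx
      have := hupos x (interior_subset hx)
      positivity
  have hh : MonotoneOn (fun x => -(v x / u x + (u x * u' x)⁻¹)) (Set.Ici c) := by
    refine mono_aux c _ _ (fun x hx => ((hg x hx).add ((hp x).inv (hppos x hx).ne')).neg) ?_
    intro x hx
    have h1 := hupos x hx
    have h2 := hu'pos x hx
    have h3 : 0 ≤ qt x := (sq_nonneg k).trans (hc x hx)
    have : -(1 / u x ^ 2 + -(u' x * u' x + u x * (qt x * u x)) / (u x * u' x) ^ 2)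
        = qt x / u' x ^ 2 := by field_simp; ring
    rw [this]; positivity
  have hgh : ∀ s t, c ≤ s → c ≤ t → v s / u s ≤ v t / u t + (u t * u' t)⁻¹ := by
    intro s t hs ht
    have hm : c ≤ max s t := hs.trans (le_max_left _ _)
    have a1 := hgmono hs hm (le_max_left s t)
    have a2 := hh ht hm (le_max_right s t)
    have a3 := inv_pos.2 (hppos _ hm)
    simp only at a1 a2
    linarith
  obtain ⟨C, hC1, hC2⟩ : ∃ C, (∀ s, c ≤ s → v s / u s ≤ C) ∧
      ∀ t, c ≤ t → C ≤ v t / u t + (u t * u' t)⁻¹ := by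
    refine ⟨sSup ((fun x => v x / u x) '' Set.Ici c), fun s hs => ?_, fun t ht => ?_⟩
    · refine le_csSup ⟨v c / u c + (u c * u' c)⁻¹, ?_⟩ ⟨s, hs, rfl⟩
      rintro _ ⟨r, hr, rfl⟩
      exact hgh r c hr le_rfl
    · refine csSup_le ⟨_, c, Set.self_mem_Ici, rfl⟩ ?_
      rintro _ ⟨r, hr, rfl⟩
      exact hgh r t hr ht
  have hy : ∀ x, HasDerivAt (fun x => C * u x - v x) (C * u' x - v' x) x :=
    fun x => ((hu x).const_mul C).sub (hv x)
  have hy' : ∀ x, HasDerivAt (fun x => C * u' x - v' x) (qt x * (C * u x - v x)) x := by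
    intro x
    refine (((hu' x).const_mul C).sub (hv' x)).congr_deriv ?_
    ring
  have hdy : deriv (fun x => C * u x - v x) = fun x => C * u' x - v' x := funext fun x => (hy x).deriv
  have hdy' : deriv (fun x => C * u' x - v' x) = fun x => qt x * (C * u x - v x) :=
    funext fun x => (hy' x).deriv
  have hyc : Continuous fun x => C * u x - v x :=
    continuous_iff_continuousAt.2 fun x => (hy x).continuousAt
  have hpos : ∀ x, c ≤ x → 0 < C * u x - v x := by
    intro x hx
    have h1 : v x / u x < C := lt_of_lt_of_le
      (hgs hx (show c ≤ x + 1 by linarith) (by linarith)) (hC1 (x + 1) (by linarith))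
    rw [div_lt_iff₀ (hupos x hx)] at h1
    linarith
  refine ⟨fun x => C * u x - v x, ?_, ?_, c, max c (k * c), le_max_left _ _, hpos, ?_⟩
  · rw [show (2 : WithTop ℕ∞) = 1 + 1 by norm_num, contDiff_succ_iff_deriv]
    refine ⟨fun x => (hy x).differentiableAt, by simp, ?_⟩
    rw [hdy, contDiff_one_iff_deriv]
    refine ⟨fun x => (hy' x).differentiableAt, ?_⟩
    rw [hdy']
    exact hqt.mul hyc
  · intro x
    rw [hdy, hdy']; ring
  · intro x hx
    have hx1 : c ≤ x := (le_max_left _ _).trans hx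
    have hx2 : k * c ≤ x := (le_max_right _ _).trans hx
    rw [abs_of_pos (hpos x hx1)]
    have h1 := hupos x hx1
    have h2 := hu'pos x hx1
    have h3 : C * u x - v x ≤ (u' x)⁻¹ := by
      have := mul_le_mul_of_nonneg_right (hC2 x hx1) h1.le
      have e : (v x / u x + (u x * u' x)⁻¹) * u x = v x + (u' x)⁻¹ := by field_simp
      linarith
    refine h3.trans ?_
    rw [neg_mul, Real.exp_neg]
    refine inv_anti₀ (Real.exp_pos _) (le_trans ?_ (hu'low x hx1))
    have h4 : Real.exp (M * x) ≤ Real.exp (k * (x - c)) := by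
      apply Real.exp_le_exp.2
      rw [mul_sub]; subst hk; linarith
    nlinarith [Real.exp_pos (k * (x - c))]
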